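/- Under the exclusive policy, the strategy A★ is a symmetric equilibrium for k players: for every strategy B, U_{A★}(B) ≤ U_{A★}(A★). -/

import Mathlib

open Finset

/-- `A` is a doubly-substochastic `M × T` matrix: boxes `1..M`, rounds `1..T`,
nonnegative entries, every row and every column sums to at most 1. -/
def Substochastic (M T : ℕ) (A : ℕ → ℕ → ℝ) : Prop :=
  (∀ x t, 0 ≤ A x t) ∧
  (∀ x ∈ Icc 1 M, ∑ t ∈ Icc 1 T, A x t ≤ 1) ∧
  (∀ t ∈ Icc 1 T, ∑ x ∈ Icc 1 M, A x t ≤ 1)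

/-- `N̄_A(x,t)`: the probability that `A` does not visit box `x` by (and including) round `t`. -/
def Nbar (A : ℕ → ℕ → ℝ) (x t : ℕ) : ℝ := 1 - ∑ s ∈ Icc 1 t, A x s

/-- `f` is a positive, nonincreasing probability distribution on boxes `1..M`. -/
def BoxDist (M : ℕ) (f : ℕ → ℝ) : Prop :=
  (∀ x ∈ Icc 1 M, 0 < f x) ∧
  (∀ x, 1 ≤ x → x + 1 ≤ M → f (x + 1) ≤ f x) ∧
  (∑ x ∈ Icc 1 M, f x = 1)

/-- `C` is a congestion policy for `k` players: nonnegative, nonincreasing on `1..k`,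
`C 1 = 1`, and `C ℓ < 1` for some `ℓ ≤ k`. -/
def Policy (k : ℕ) (C : ℕ → ℝ) : Prop :=
  (∀ ℓ, 1 ≤ ℓ → ℓ ≤ k → 0 ≤ C ℓ) ∧ (C 1 = 1) ∧
  (∀ ℓ ℓ', 1 ≤ ℓ → ℓ ≤ ℓ' → ℓ' ≤ k → C ℓ' ≤ C ℓ) ∧
  (∃ ℓ, 1 ≤ ℓ ∧ ℓ ≤ k ∧ C ℓ < 1)

/-- The value of box `x` at round `t` against `k-1` copies of `A`. -/
def val (k : ℕ) (C f : ℕ → ℝ) (A : ℕ → ℕ → ℝ) (x t : ℕ) : ℝ :=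
  f x * ∑ ℓ ∈ range k,
    C (ℓ + 1) * ((k - 1).choose ℓ : ℝ) * A x t ^ ℓ * Nbar A x t ^ (k - 1 - ℓ)

/-- The utility of `B` against `k-1` copies of `A`. -/
def util (M T k : ℕ) (C f : ℕ → ℝ) (A B : ℕ → ℕ → ℝ) : ℝ :=
  ∑ t ∈ Icc 1 T, ∑ x ∈ Icc 1 M, B x t * val k C f A x t

/-- `A` is non-redundant: each column `t ≤ min T M` sums to exactly 1. -/
def NonRedundant (M T : ℕ) (A : ℕ → ℕ → ℝ) : Prop :=
  ∀ t, 1 ≤ t → t ≤ min T M → ∑ x ∈ Icc 1 M, A x t = 1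

/-- `A` is self-greedy: for each round `t ≤ T` it is greedy at round `t` with respect to
`k-1` copies of itself. -/
def SGreedy (M T k : ℕ) (C f : ℕ → ℝ) (A : ℕ → ℕ → ℝ) : Prop :=
  ∀ t, 1 ≤ t → t ≤ T → ∀ B, Substochastic M T B →
    (∀ x s, s < t → B x s = A x s) →
    ∑ x ∈ Icc 1 M, B x t * val k C f A x t ≤ ∑ x ∈ Icc 1 M, A x t * val k C f A x t

/-- The value of box `x` at round `t` against `k-1` copies of `A` under the exclusive policy. -/
def exVal (k : ℕ) (f : ℕ → ℝ) (A : ℕ → ℕ → ℝ) (x t : ℕ) : ℝ :=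
  f x * Nbar A x t ^ (k - 1)

/-- The utility of `B` against `k-1` copies of `A` under the exclusive policy. -/
def exUtil (M T k : ℕ) (f : ℕ → ℝ) (A B : ℕ → ℕ → ℝ) : ℝ :=
  ∑ t ∈ Icc 1 T, ∑ x ∈ Icc 1 M, B x t * exVal k f A x t

/-- `A` is the strategy `A★` of [JACM] for `k` players: substochastic, visits nothing after
round `M`, and for each `t ≤ min T M` there is `α(t) ≥ 0` with
`N̄(x,t) = min 1 (α(t) · f(x)^{-1/(k-1)})` and `∑_x N̄(x,t) = M - t`. -/
def IsAstar (M T k : ℕ) (f : ℕ → ℝ) (A : ℕ → ℕ → ℝ) : Prop :=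
  Substochastic M T A ∧
  (∀ x ∈ Icc 1 M, ∀ t ∈ Icc 1 T, M < t → A x t = 0) ∧
  (∀ t, 1 ≤ t → t ≤ min T M → ∃ α : ℝ, 0 ≤ α ∧
    (∀ x ∈ Icc 1 M, Nbar A x t = min 1 (α * f x ^ (-(1 : ℝ) / ((k : ℝ) - 1)))) ∧
    (∑ x ∈ Icc 1 M, Nbar A x t = (M : ℝ) - (t : ℝ)))

theorem Nbar_succ (A : ℕ → ℕ → ℝ) (x t : ℕ) : Nbar A x (t + 1) = Nbar A x t - A x (t + 1) := by
  simp only [Nbar, Finset.sum_Icc_succ_top (Nat.le_add_left 1 t)]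
  ring

theorem Nbar_antitone {A : ℕ → ℕ → ℝ} (hA : ∀ x t, 0 ≤ A x t) (x : ℕ) : Antitone (Nbar A x) :=
  antitone_nat_of_succ_le fun t => by
    rw [Nbar_succ]
    linarith [hA x (t + 1)]

theorem Nbar_nonneg {M T : ℕ} {A : ℕ → ℕ → ℝ} (hA : Substochastic M T A) {x t : ℕ}
    (hx : x ∈ Icc 1 M) (ht : t ≤ T) : 0 ≤ Nbar A x t := by
  refine le_trans ?_ (Nbar_antitone hA.1 x ht)
  simpa [Nbar] using hA.2.1 x hx

theorem IsAstar.sum_Nbar {M T k : ℕ} {f : ℕ → ℝ} {A : ℕ → ℕ → ℝ} (h : IsAstar M T k f A)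
    {t : ℕ} (ht : t ≤ min T M) : ∑ x ∈ Icc 1 M, Nbar A x t = (M : ℝ) - (t : ℝ) := by
  rcases Nat.eq_zero_or_pos t with rfl | ht0
  · simp [Nbar]
  · obtain ⟨α, -, -, hsum⟩ := h.2.2 t ht0 ht
    exact hsum

theorem IsAstar.column_sum {M T k : ℕ} {f : ℕ → ℝ} {A : ℕ → ℕ → ℝ} (h : IsAstar M T k f A)
    {t : ℕ} (ht : t + 1 ≤ min T M) : ∑ x ∈ Icc 1 M, A x (t + 1) = 1 := by
  have h₁ := h.sum_Nbar ht
  have h₀ := h.sum_Nbar (Nat.le_of_succ_le ht)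
  simp only [Nbar_succ, Finset.sum_sub_distrib] at h₁
  push_cast at h₁
  linarith

theorem IsAstar.exVal_eq_zero {M T k : ℕ} (hk : 2 ≤ k) {f : ℕ → ℝ} {A : ℕ → ℕ → ℝ}
    (h : IsAstar M T k f A) {x t : ℕ} (hx : x ∈ Icc 1 M) (htT : t ≤ T) (hMt : M < t) :
    exVal k f A x t = 0 := by
  have hM : M ≤ T := hMt.le.trans htT
  have hsum := h.sum_Nbar (t := M) (le_min hM le_rfl)
  rw [sub_self, Finset.sum_eq_zero_iff_of_nonneg fun y hy => Nbar_nonneg h.1 hy hM] at hsum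
  have hN : Nbar A x t = 0 :=
    le_antisymm ((Nbar_antitone h.1.1 x hMt.le).trans_eq (hsum x hx)) (Nbar_nonneg h.1 hx htT)
  rw [exVal, hN, zero_pow (by omega), mul_zero]

theorem mul_mul_rpow_neg_inv_pow {k : ℕ} (hk : 2 ≤ k) {y : ℝ} (hy : 0 < y) (α : ℝ) :
    y * (α * y ^ (-(1 : ℝ) / ((k : ℝ) - 1))) ^ (k - 1) = α ^ (k - 1) := by
  have hk' : (k : ℝ) - 1 ≠ 0 := by
    have : (2 : ℝ) ≤ k := by exact_mod_cast hk
    linarith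
  have hpow : (y ^ (-(1 : ℝ) / ((k : ℝ) - 1))) ^ (k - 1) = y⁻¹ := by
    rw [← Real.rpow_natCast, ← Real.rpow_mul hy.le, Nat.cast_sub (by omega), Nat.cast_one,
      div_mul_cancel₀ _ hk', Real.rpow_neg_one]
  rw [mul_pow, hpow]
  field_simp

/-- In a round `t ≤ min T M` there is a level that bounds the value of every box, and that is
attained by every box which `A★` visits with positive probability. -/
theorem IsAstar.exists_level {M T k : ℕ} (hk : 2 ≤ k) {f : ℕ → ℝ} (hf : ∀ x ∈ Icc 1 M, 0 < f x)
    {A : ℕ → ℕ → ℝ} (h : IsAstar M T k f A) {t : ℕ} (ht : t + 1 ≤ min T M) :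
    ∃ c : ℝ, 0 ≤ c ∧ ∀ x ∈ Icc 1 M,
      exVal k f A x (t + 1) ≤ c ∧ A x (t + 1) * exVal k f A x (t + 1) = A x (t + 1) * c := by
  obtain ⟨α, hα, hN, -⟩ := h.2.2 (t + 1) (Nat.le_add_left 1 t) ht
  refine ⟨α ^ (k - 1), pow_nonneg hα _, fun x hx => ?_⟩
  have hfx := hf x hx
  rw [← mul_mul_rpow_neg_inv_pow hk hfx α, exVal]
  constructor
  · have hN0 := Nbar_nonneg h.1 hx (ht.trans (min_le_left T M))
    have hle : Nbar A x (t + 1) ≤ α * f x ^ (-(1 : ℝ) / ((k : ℝ) - 1)) :=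
      (hN x hx).trans_le (min_le_right _ _)
    gcongr
  · rcases (h.1.1 x (t + 1)).eq_or_lt with hA | hA
    · rw [← hA, zero_mul, zero_mul]
    · have hlt : Nbar A x (t + 1) < 1 := by
        have h₀ : Nbar A x t ≤ 1 := by
          simpa [Nbar] using Nbar_antitone h.1.1 x (Nat.zero_le t)
        rw [Nbar_succ]
        linarith
      rcases min_choice 1 (α * f x ^ (-(1 : ℝ) / ((k : ℝ) - 1))) with hm | hm
      · rw [hN x hx, hm] at hlt
        exact absurd hlt (lt_irrefl 1)
      · rw [hN x hx, hm]

/-- under the exclusive policy, `A★` is a symmetric equilibrium for `k` players. -/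
theorem Astar_symmetric_equilibrium
    (M T k : ℕ) (hM : 1 ≤ M) (hT : 1 ≤ T) (hk : 2 ≤ k)
    (f : ℕ → ℝ) (hf : BoxDist M f)
    (Astar : ℕ → ℕ → ℝ) (hAstar : IsAstar M T k f Astar) :
    ∀ B, Substochastic M T B →
      exUtil M T k f Astar B ≤ exUtil M T k f Astar Astar := by
  intro B hB
  refine Finset.sum_le_sum fun t ht => ?_
  obtain ⟨ht1, htT⟩ := Finset.mem_Icc.mp ht
  rcases lt_or_ge M t with hMt | htM
  · refine Finset.sum_le_sum fun x hx => ?_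
    rw [hAstar.exVal_eq_zero hk hx htT hMt, mul_zero, mul_zero]
  · obtain ⟨s, rfl⟩ := Nat.exists_eq_add_of_le' ht1
    have hs : s + 1 ≤ min T M := le_min htT htM
    obtain ⟨c, hc, hval⟩ := hAstar.exists_level hk hf.1 hs
    calc ∑ x ∈ Icc 1 M, B x (s + 1) * exVal k f Astar x (s + 1)
        ≤ ∑ x ∈ Icc 1 M, B x (s + 1) * c :=
          Finset.sum_le_sum fun x hx => mul_le_mul_of_nonneg_left (hval x hx).1 (hB.1 x (s + 1))
      _ = (∑ x ∈ Icc 1 M, B x (s + 1)) * c := (Finset.sum_mul ..).symm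
      _ ≤ 1 * c := mul_le_mul_of_nonneg_right (hB.2.2 (s + 1) ht) hc
      _ = ∑ x ∈ Icc 1 M, Astar x (s + 1) * c := by
          rw [← Finset.sum_mul, hAstar.column_sum hs]
      _ = ∑ x ∈ Icc 1 M, Astar x (s + 1) * exVal k f Astar x (s + 1) :=
          Finset.sum_congr rfl fun x hx => (hval x hx).2.symm
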